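/- Let X be a real Banach space, φ : X → ℝ and V : X → X locally Lipschitz, S ⊆ X, and c > 0 such that ⟨x*, V(x)⟩ ≥ c for every x ∈ S and every x* ∈ ∂φ(x), and ⟨x*, V(x)⟩ ≥ 0 for every x ∈ X and x* ∈ ∂φ(x). If σ : [0,T) → X solves σ' = −V(σ) and σ(s) ∈ S for all s ∈ [0,t], where t < T, then φ(σ(t)) ≤ φ(σ(0)) − c·t. (Quantitative descent estimate (2.18), used in Lemma 2.4, part 5) -/

import Mathlib

open Filter Topology Set

noncomputable section

variable {X : Type*} [NormedAddCommGroup X] [NormedSpace ℝ X]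

/-- Clarke generalized directional derivative of a locally Lipschitz functional. -/
def clarkeDeriv (φ : X → ℝ) (x h : X) : ℝ :=
  Filter.limsup (fun p : X × ℝ => (φ (p.1 + p.2 • h) - φ p.1) / p.2)
    ((𝓝 x) ×ˢ (𝓝[>] (0 : ℝ)))

/-- Clarke subdifferential. -/
def clarkeSubdiff (φ : X → ℝ) (x : X) : Set (X →L[ℝ] ℝ) :=
  {xs | ∀ h : X, xs h ≤ clarkeDeriv φ x h}

/-- On a neighbourhood where `φ` is `K`-Lipschitz the difference quotients are bounded. -/
theorem LocallyLipschitz.eventually_abs_quotient_le {φ : X → ℝ} (hφ : LocallyLipschitz φ) (x : X) :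
    ∃ K : ℝ, 0 ≤ K ∧ ∀ h : X, ∀ᶠ p : X × ℝ in (𝓝 x) ×ˢ (𝓝[>] (0 : ℝ)),
      |(φ (p.1 + p.2 • h) - φ p.1) / p.2| ≤ K * ‖h‖ := by
  obtain ⟨K, U, hU, hK⟩ := hφ x
  refine ⟨K, K.2, fun h => ?_⟩
  have hfst : Tendsto (fun p : X × ℝ => p.1) ((𝓝 x) ×ˢ (𝓝[>] (0 : ℝ))) (𝓝 x) := tendsto_fst
  have hsnd : Tendsto (fun p : X × ℝ => p.2) ((𝓝 x) ×ˢ (𝓝[>] (0 : ℝ))) (𝓝[>] 0) := tendsto_snd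
  have hadd : Tendsto (fun p : X × ℝ => p.1 + p.2 • h) ((𝓝 x) ×ˢ (𝓝[>] (0 : ℝ))) (𝓝 x) := by
    simpa using hfst.add ((tendsto_nhds_of_tendsto_nhdsWithin hsnd).smul_const h)
  filter_upwards [hfst hU, hadd hU, hsnd self_mem_nhdsWithin] with p hp hph hp0
  have hp0 : 0 < p.2 := hp0
  rw [abs_div, abs_of_pos hp0, div_le_iff₀ hp0]
  have := hK.dist_le_mul _ hph _ hp
  rw [Real.dist_eq, dist_eq_norm, add_sub_cancel_left, norm_smul, Real.norm_of_nonneg hp0.le] at this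
  linarith

theorem LocallyLipschitz.eventually_quotient_lt {φ : X → ℝ} (hφ : LocallyLipschitz φ) {x h : X}
    {r : ℝ} (hr : clarkeDeriv φ x h < r) :
    ∀ᶠ p : X × ℝ in (𝓝 x) ×ˢ (𝓝[>] (0 : ℝ)), (φ (p.1 + p.2 • h) - φ p.1) / p.2 < r := by
  obtain ⟨K, -, hK⟩ := hφ.eventually_abs_quotient_le x
  exact eventually_lt_of_limsup_lt hr
    (isBoundedUnder_of_eventually_le ((hK h).mono fun _ hp => (abs_le.1 hp).2))

theorem LocallyLipschitz.clarkeDeriv_le {φ : X → ℝ} (hφ : LocallyLipschitz φ) {x h : X} {r : ℝ}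
    (hr : ∀ᶠ p : X × ℝ in (𝓝 x) ×ˢ (𝓝[>] (0 : ℝ)), (φ (p.1 + p.2 • h) - φ p.1) / p.2 ≤ r) :
    clarkeDeriv φ x h ≤ r := by
  obtain ⟨K, -, hK⟩ := hφ.eventually_abs_quotient_le x
  exact limsup_le_of_le (IsBoundedUnder.isCoboundedUnder_le
    (isBoundedUnder_of_eventually_ge ((hK h).mono fun _ hp => (abs_le.1 hp).1))) hr

theorem LocallyLipschitz.exists_clarkeDeriv_le_mul_norm {φ : X → ℝ} (hφ : LocallyLipschitz φ)
    (x : X) : ∃ K : ℝ, 0 ≤ K ∧ ∀ h : X, clarkeDeriv φ x h ≤ K * ‖h‖ := by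
  obtain ⟨K, hK0, hK⟩ := hφ.eventually_abs_quotient_le x
  exact ⟨K, hK0, fun h => hφ.clarkeDeriv_le ((hK h).mono fun _ hp => (abs_le.1 hp).2)⟩

theorem LocallyLipschitz.clarkeDeriv_add_le {φ : X → ℝ} (hφ : LocallyLipschitz φ) (x h k : X) :
    clarkeDeriv φ x (h + k) ≤ clarkeDeriv φ x h + clarkeDeriv φ x k := by
  refine le_of_forall_pos_le_add fun ε hε => ?_
  have hshift : Tendsto (fun p : X × ℝ => (p.1 + p.2 • h, p.2)) ((𝓝 x) ×ˢ (𝓝[>] (0 : ℝ)))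
      ((𝓝 x) ×ˢ (𝓝[>] (0 : ℝ))) := by
    refine Tendsto.prodMk ?_ tendsto_snd
    simpa using (tendsto_fst (f := 𝓝 x) (g := 𝓝[>] (0 : ℝ))).add
      ((tendsto_nhds_of_tendsto_nhdsWithin
        (tendsto_snd (f := 𝓝 x) (g := 𝓝[>] (0 : ℝ)))).smul_const h)
  apply hφ.clarkeDeriv_le
  filter_upwards [hφ.eventually_quotient_lt (lt_add_of_pos_right (clarkeDeriv φ x h) (half_pos hε)),
    hshift.eventually (hφ.eventually_quotient_lt
      (lt_add_of_pos_right (clarkeDeriv φ x k) (half_pos hε)))] with p hp hp'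
  have hsplit : (φ (p.1 + p.2 • (h + k)) - φ p.1) / p.2 =
      (φ (p.1 + p.2 • h + p.2 • k) - φ (p.1 + p.2 • h)) / p.2 +
        (φ (p.1 + p.2 • h) - φ p.1) / p.2 := by
    rw [smul_add, ← add_assoc]
    ring
  rw [hsplit]
  linarith

theorem LocallyLipschitz.clarkeDeriv_smul_le {φ : X → ℝ} (hφ : LocallyLipschitz φ) (x : X) {a : ℝ}
    (ha : 0 < a) (h : X) : clarkeDeriv φ x (a • h) ≤ a * clarkeDeriv φ x h := by
  refine le_of_forall_gt_imp_ge_of_dense fun r hr => ?_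
  have hscale : Tendsto (fun p : X × ℝ => (p.1, p.2 * a)) ((𝓝 x) ×ˢ (𝓝[>] (0 : ℝ)))
      ((𝓝 x) ×ˢ (𝓝[>] (0 : ℝ))) := by
    refine Tendsto.prodMk tendsto_fst (Tendsto.comp (g := fun y : ℝ => y * a) ?_ tendsto_snd)
    refine tendsto_nhdsWithin_iff.2 ⟨?_, ?_⟩
    · simpa using (tendsto_nhdsWithin_of_tendsto_nhds (s := Ioi (0 : ℝ))
        (tendsto_id (x := 𝓝 (0 : ℝ)))).mul_const a
    · filter_upwards [self_mem_nhdsWithin] with y hy using mul_pos hy ha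
  apply hφ.clarkeDeriv_le
  have hr' : clarkeDeriv φ x h < r / a := by rwa [lt_div_iff₀ ha, mul_comm]
  filter_upwards [hscale.eventually (hφ.eventually_quotient_lt hr')] with p hp
  rw [← smul_smul, ← div_div, div_lt_div_iff_of_pos_right ha] at hp
  exact hp.le

theorem LocallyLipschitz.clarkeDeriv_smul {φ : X → ℝ} (hφ : LocallyLipschitz φ) (x : X) {a : ℝ}
    (ha : 0 < a) (h : X) : clarkeDeriv φ x (a • h) = a * clarkeDeriv φ x h := by
  refine le_antisymm (hφ.clarkeDeriv_smul_le x ha h) ?_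
  have := hφ.clarkeDeriv_smul_le x (inv_pos.2 ha) (a • h)
  rwa [inv_smul_smul₀ ha.ne', ← div_eq_inv_mul, le_div_iff₀ ha, mul_comm] at this

/-- The generalized directional derivative is attained by an element of the subdifferential. -/
theorem LocallyLipschitz.exists_mem_clarkeSubdiff_eq {φ : X → ℝ} (hφ : LocallyLipschitz φ)
    (x v : X) : ∃ xs ∈ clarkeSubdiff φ x, xs v = clarkeDeriv φ x v := by
  have hzero : clarkeDeriv φ x 0 = 0 := by simp [clarkeDeriv]
  have hspan : ∀ a : ℝ, a • v = 0 → a • clarkeDeriv φ x v = 0 := by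
    intro a hav
    rcases smul_eq_zero.1 hav with rfl | rfl
    · simp
    · simp [hzero]
  obtain ⟨g, hgv, hg⟩ := exists_extension_of_le_sublinear
    (LinearPMap.mkSpanSingleton' v (clarkeDeriv φ x v) hspan) (clarkeDeriv φ x)
    (fun a ha h => hφ.clarkeDeriv_smul x ha h) (hφ.clarkeDeriv_add_le x) (by
      rintro ⟨y, hy⟩
      obtain ⟨a, rfl⟩ := Submodule.mem_span_singleton.1 hy
      rw [LinearPMap.mkSpanSingleton'_apply, RingHom.id_apply, smul_eq_mul]
      rcases lt_trichotomy a 0 with ha | rfl | ha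
      · have hsum := hφ.clarkeDeriv_add_le x (a • v) ((-a) • v)
        rw [hφ.clarkeDeriv_smul x (neg_pos.2 ha), neg_smul, add_neg_cancel, hzero] at hsum
        linarith
      · simp [hzero]
      · exact (hφ.clarkeDeriv_smul x ha v).ge)
  obtain ⟨K, -, hK⟩ := hφ.exists_clarkeDeriv_le_mul_norm x
  refine ⟨g.mkContinuous K fun y => abs_le.2 ⟨?_, (hg y).trans (hK y)⟩, hg, ?_⟩
  · have := (hg (-y)).trans (hK (-y))
    rw [map_neg, norm_neg] at this
    linarith
  · exact (hgv ⟨v, Submodule.mem_span_singleton_self v⟩).trans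
      (LinearPMap.mkSpanSingleton'_apply_self v _ hspan _)

/-- The upper right Dini derivative of `φ ∘ σ` is at most the generalized directional derivative
of `φ` along the velocity of `σ`. -/
theorem LocallyLipschitz.eventually_slope_comp_lt {φ : X → ℝ} (hφ : LocallyLipschitz φ)
    {σ : ℝ → X} {v : X} {s r : ℝ} (hσ : HasDerivAt σ v s) (hr : clarkeDeriv φ (σ s) v < r) :
    ∀ᶠ z in 𝓝[>] s, slope (φ ∘ σ) s z < r := by
  obtain ⟨r', hr', hr'r⟩ := exists_between hr
  obtain ⟨K, U, hU, hK⟩ := hφ (σ s)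
  have hK1 : (0 : ℝ) < K + 1 := by positivity
  have hsub : Tendsto (fun z : ℝ => z - s) (𝓝[>] s) (𝓝[>] 0) := by
    refine tendsto_nhdsWithin_iff.2 ⟨?_, ?_⟩
    · have : Tendsto (fun z : ℝ => z - s) (𝓝 s) (𝓝 (s - s)) := tendsto_id.sub_const s
      rw [sub_self] at this
      exact this.mono_left nhdsWithin_le_nhds
    · filter_upwards [self_mem_nhdsWithin] with z hz using sub_pos.2 (mem_Ioi.1 hz)
  have hquot := (Tendsto.prodMk (tendsto_const_nhds (x := σ s)) hsub).eventually
    (hφ.eventually_quotient_lt hr')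
  have hline : Tendsto (fun z : ℝ => σ s + (z - s) • v) (𝓝[>] s) (𝓝 (σ s)) := by
    simpa using ((tendsto_nhds_of_tendsto_nhdsWithin hsub).smul_const v).const_add (σ s)
  have hcurve : Tendsto σ (𝓝[>] s) (𝓝 (σ s)) :=
    hσ.continuousAt.tendsto.mono_left nhdsWithin_le_nhds
  have herr := ((hasDerivAt_iff_isLittleO.1 hσ).def (div_pos (sub_pos.2 hr'r) hK1)).filter_mono
    (nhdsWithin_le_nhds (s := Ioi s))
  filter_upwards [hquot, hline hU, hcurve hU, herr, self_mem_nhdsWithin] with z hq hl hz he hsz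
  have hpos : 0 < z - s := sub_pos.2 hsz
  have hlip := (le_abs_self _).trans (hK.dist_le_mul _ hz _ hl)
  rw [dist_eq_norm, ← sub_sub] at hlip
  rw [Real.norm_of_nonneg hpos.le] at he
  have hKerr : (K : ℝ) * ‖σ z - σ s - (z - s) • v‖ ≤ (r - r') * (z - s) := by
    calc (K : ℝ) * ‖σ z - σ s - (z - s) • v‖
        ≤ (K + 1) * ((r - r') / (K + 1) * (z - s)) := by
          gcongr
          linarith
      _ = (r - r') * (z - s) := by field_simp
  rw [div_lt_iff₀ hpos] at hq
  rw [slope_def_field, div_lt_iff₀ hpos]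
  simp only [Function.comp_apply]
  linarith

/-- **Descent estimate (2.18).** If `⟨x*, V(x)⟩ ≥ c` on `S` and `⟨x*, V(x)⟩ ≥ 0`
everywhere, then along a solution of `σ' = -V(σ)` staying in `S` on `[0,t]` one has
`φ(σ(t)) ≤ φ(σ(0)) - c·t`. -/
theorem descent_estimate_2_18
    {X : Type*} [NormedAddCommGroup X] [NormedSpace ℝ X]
    (φ : X → ℝ) (hφ : LocallyLipschitz φ)
    (V : X → X) (hV : LocallyLipschitz V)
    (S : Set X) (c : ℝ) (hc : 0 < c)
    (hS : ∀ x ∈ S, ∀ xs ∈ clarkeSubdiff φ x, c ≤ xs (V x))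
    (hpos : ∀ x : X, ∀ xs ∈ clarkeSubdiff φ x, 0 ≤ xs (V x))
    (T : ℝ) (σ : ℝ → X)
    (hσ : ∀ s ∈ Set.Ico (0 : ℝ) T, HasDerivAt σ (-V (σ s)) s)
    (t : ℝ) (ht0 : 0 ≤ t) (htT : t < T)
    (hstay : ∀ s ∈ Set.Icc (0 : ℝ) t, σ s ∈ S) :
    φ (σ t) ≤ φ (σ 0) - c * t := by
  have hcont : ContinuousOn (φ ∘ σ) (Icc 0 t) := fun s hs =>
    (hφ.continuous.continuousAt.comp
      (hσ s ⟨hs.1, hs.2.trans_lt htT⟩).continuousAt).continuousWithinAt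
  refine image_le_of_liminf_slope_right_le_deriv_boundary hcont
    (B := fun s => φ (σ 0) - c * s) (B' := fun _ => -c) (by simp) (by fun_prop)
    (fun s _ => ?_) (fun s hs r hr => ?_) (right_mem_Icc.2 ht0)
  · simpa using (((hasDerivAt_id s).const_mul c).const_sub (φ (σ 0))).hasDerivWithinAt
  · obtain ⟨xs, hxs, hxsV⟩ := hφ.exists_mem_clarkeSubdiff_eq (σ s) (-V (σ s))
    have hle := hS _ (hstay s (Ico_subset_Icc_self hs)) xs hxs
    rw [map_neg] at hxsV
    exact (hφ.eventually_slope_comp_lt (hσ s ⟨hs.1, hs.2.trans htT⟩)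
      (by linarith)).frequently

end
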